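/- Let F be a field, Ω a quiver, and V an indecomposable representation of Ω over F which is not isomorphic to the simple representation L_i. If i is a sink of Ω, then the map Σ_{a : t(a)=i} V(a) : ⊕_{a : t(a)=i} V(s(a)) → V(i) is surjective; if i is a source of Ω, then the map (V(a))_{a : s(a)=i} : V(i) → ⊕_{a : s(a)=i} V(t(a)) is injective. -/

import Mathlib

/-- A quiver: a set of vertices, a set of arrows, with source and target maps. -/
structure Quiv : Type 1 where
  V : Type
  A : Type
  s : A → V
  t : A → V

/-- A representation of a quiver over a field `F`. -/
structure QRep (F : Type) [Field F] (Q : Quiv) : Type 1 where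
  M : Q.V → Type
  [acg : ∀ i, AddCommGroup (M i)]
  [mod : ∀ i, Module F (M i)]
  map : ∀ a : Q.A, M (Q.s a) →ₗ[F] M (Q.t a)

attribute [instance] QRep.acg QRep.mod

namespace QRep

variable {F : Type} [Field F] {Q : Quiv}

/-- A representation is nonzero if some vertex space has a nonzero vector. -/
def Nonzero (V : QRep F Q) : Prop := ∃ i, ∃ x : V.M i, x ≠ 0

/-- A morphism of representations. -/
structure Hom (V W : QRep F Q) : Type where
  app : ∀ i, V.M i →ₗ[F] W.M i
  comm : ∀ a : Q.A, (W.map a).comp (app (Q.s a)) = (app (Q.t a)).comp (V.map a)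

/-- A morphism is an isomorphism iff it is bijective at each vertex. -/
def Hom.IsIso {V W : QRep F Q} (f : Hom V W) : Prop := ∀ i, Function.Bijective (f.app i)

/-- Two representations are isomorphic. -/
def Iso (V W : QRep F Q) : Prop := ∃ f : Hom V W, f.IsIso

/-- The (external) direct sum of two representations. -/
def dsum (V W : QRep F Q) : QRep F Q where
  M i := V.M i × W.M i
  map a := (V.map a).prodMap (W.map a)

/-- A representation is indecomposable if it is nonzero and not isomorphic to a direct
sum of two nonzero representations. -/
def Indec (V : QRep F Q) : Prop :=
  V.Nonzero ∧ ∀ A B : QRep F Q, A.Nonzero → B.Nonzero → ¬ Iso V (dsum A B)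

/-- FLEI: locally finite-dimensional, and all but finitely many arrow maps are
isomorphisms. -/
def IsFLEI (V : QRep F Q) : Prop :=
  (∀ i, FiniteDimensional F (V.M i)) ∧ {a : Q.A | ¬ Function.Bijective (V.map a)}.Finite

end QRep

/-- A subrepresentation: a subspace at each vertex, stable under the arrow maps. -/
structure Subrep {F : Type} [Field F] {Q : Quiv} (V : QRep F Q) : Type where
  S : ∀ i, Submodule F (V.M i)
  stable : ∀ a : Q.A, ∀ x ∈ S (Q.s a), V.map a x ∈ S (Q.t a)

namespace Subrep

variable {F : Type} [Field F] {Q : Quiv} {V : QRep F Q}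

/-- A subrepresentation, viewed as a representation in its own right. -/
def toRep (W : Subrep V) : QRep F Q where
  M i := ↥(W.S i)
  map a := (V.map a).restrict (W.stable a)

/-- The quotient of a representation by a subrepresentation. -/
def quot (W : Subrep V) : QRep F Q where
  M i := V.M i ⧸ W.S i
  map a := Submodule.mapQ _ _ (V.map a) (fun x hx => W.stable a x hx)

end Subrep
/-- A vertex is a sink if it is the source of no arrow. -/
def Quiv.IsSink (Q : Quiv) (i : Q.V) : Prop := ∀ a : Q.A, Q.s a ≠ i

/-- A vertex is a source if it is the target of no arrow. -/
def Quiv.IsSource (Q : Quiv) (i : Q.V) : Prop := ∀ a : Q.A, Q.t a ≠ i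

namespace QRep

open DirectSum

variable {F : Type} [Field F] {Q : Quiv}

/-- Transport of vertex spaces along an equality of vertices. -/
def castLE (V : QRep F Q) {j k : Q.V} (h : j = k) : V.M j ≃ₗ[F] V.M k := by
  subst h; exact LinearEquiv.refl F (V.M j)

open Classical in
/-- The canonical map `⊕_{a : t(a) = i} V(s(a)) → V(i)` given by `Σ_a V(a)`. -/
noncomputable def sumIn (V : QRep F Q) (i : Q.V) :
    (⨁ a : {a : Q.A // Q.t a = i}, V.M (Q.s a.1)) →ₗ[F] V.M i :=
  DirectSum.toModule F _ _ (fun a => (V.castLE a.2).toLinearMap ∘ₗ V.map a.1)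

/-- The canonical map `V(i) → Π_{a : s(a) = i} V(t(a))` with components `V(a)`. -/
def prodOut (V : QRep F Q) (i : Q.V) :
    V.M i →ₗ[F] ((a : {a : Q.A // Q.s a = i}) → V.M (Q.t a.1)) :=
  LinearMap.pi (fun a => V.map a.1 ∘ₗ (V.castLE a.2.symm).toLinearMap)

/-- `V` is isomorphic to the simple representation `L_i` (one-dimensional at `i`, zero
elsewhere, all arrow maps zero). -/
def IsoToL (V : QRep F Q) (i : Q.V) : Prop :=
  Module.finrank F (V.M i) = 1 ∧ (∀ j, j ≠ i → ∀ x : V.M j, x = 0) ∧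
    (∀ a : Q.A, V.map a = 0)

end QRep

namespace Subrep

variable {F : Type} [Field F] {Q : Quiv} {V : QRep F Q}

/-- A representation is the direct sum of two vertexwise complementary subrepresentations. -/
theorem iso_dsum_of_isCompl (W W' : Subrep V) (h : ∀ j, IsCompl (W.S j) (W'.S j)) :
    QRep.Iso V (QRep.dsum W.toRep W'.toRep) := by
  refine ⟨⟨fun j => (Submodule.prodEquivOfIsCompl _ _ (h j)).symm.toLinearMap, fun a => ?_⟩,
    fun j => (Submodule.prodEquivOfIsCompl _ _ (h j)).symm.bijective⟩
  refine LinearMap.ext fun v => ?_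
  obtain ⟨⟨p, q⟩, rfl⟩ := (Submodule.prodEquivOfIsCompl _ _ (h (Q.s a))).surjective v
  change ((V.map a).restrict (W.stable a)).prodMap ((V.map a).restrict (W'.stable a))
      ((Submodule.prodEquivOfIsCompl _ _ (h (Q.s a))).symm
        (Submodule.prodEquivOfIsCompl _ _ (h (Q.s a)) (p, q))) =
    (Submodule.prodEquivOfIsCompl _ _ (h (Q.t a))).symm
      (V.map a (Submodule.prodEquivOfIsCompl _ _ (h (Q.s a)) (p, q)))
  rw [LinearEquiv.symm_apply_apply, LinearEquiv.eq_symm_apply,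
    Submodule.coe_prodEquivOfIsCompl', Submodule.coe_prodEquivOfIsCompl', map_add]
  rfl

/-- If an indecomposable representation splits into two subrepresentations, one is zero. -/
theorem eq_bot_of_indec_of_isCompl (hV : V.Indec) (W W' : Subrep V)
    (h : ∀ j, IsCompl (W.S j) (W'.S j)) {i : Q.V} (hi : W.S i ≠ ⊥) (j : Q.V) :
    W'.S j = ⊥ := by
  by_contra hj
  obtain ⟨x, hx, hx0⟩ := (Submodule.ne_bot_iff _).1 hi
  obtain ⟨y, hy, hy0⟩ := (Submodule.ne_bot_iff _).1 hj
  exact hV.2 W.toRep W'.toRep ⟨i, ⟨x, hx⟩, fun e => hx0 (congrArg Subtype.val e)⟩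
    ⟨j, ⟨y, hy⟩, fun e => hy0 (congrArg Subtype.val e)⟩ (iso_dsum_of_isCompl W W' h)

end Subrep

namespace QRep

variable {F : Type} [Field F] {Q : Quiv}

open Classical in
/-- If a line at the vertex `i` is killed by all arrows leaving `i` and has a complement
containing the images of all arrows entering `i`, then it is a direct summand, so that an
indecomposable representation containing it is `L_i`. -/
theorem Indec.isoToL {V : QRep F Q} (hV : V.Indec) {i : Q.V} {x : V.M i} (hx : x ≠ 0)
    {C : Submodule F (V.M i)} (hC : IsCompl (F ∙ x) C)
    (hout : ∀ a (h : Q.s a = i), V.map a (V.castLE h.symm x) = 0)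
    (hin : ∀ a (h : Q.t a = i) (y : V.M (Q.s a)), V.castLE h (V.map a y) ∈ C) :
    V.IsoToL i := by
  have hspan : ∀ a (y : V.M (Q.s a)),
      y ∈ Function.update (fun j => (⊥ : Submodule F (V.M j))) i (F ∙ x) (Q.s a) →
      V.map a y = 0 := by
    intro a y hy
    by_cases h : Q.s a = i
    · subst h
      rw [Function.update_self] at hy
      obtain ⟨c, rfl⟩ := Submodule.mem_span_singleton.1 hy
      rw [map_smul, show V.map a x = 0 from hout a rfl, smul_zero]
    · rw [Function.update_of_ne h] at hy
      rw [(Submodule.mem_bot F).1 hy, map_zero]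
  let W : Subrep V :=
    { S := Function.update (fun j => (⊥ : Submodule F (V.M j))) i (F ∙ x)
      stable := fun a y hy => by
        rw [hspan a y hy]
        exact Submodule.zero_mem _ }
  let W' : Subrep V :=
    { S := Function.update (fun j => (⊤ : Submodule F (V.M j))) i C
      stable := fun a y _ => by
        by_cases h : Q.t a = i
        · subst h
          rw [Function.update_self]
          exact hin a rfl y
        · rw [Function.update_of_ne h]
          exact Submodule.mem_top }
  have hWi : W.S i = F ∙ x :=
    Function.update_self i (F ∙ x) fun j => (⊥ : Submodule F (V.M j))
  have hWj : ∀ j, j ≠ i → W.S j = ⊥ := fun j h =>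
    Function.update_of_ne h (F ∙ x) fun j => (⊥ : Submodule F (V.M j))
  have hcompl : ∀ j, IsCompl (W.S j) (W'.S j) := by
    intro j
    by_cases h : j = i
    · subst h
      rw [hWi, show W'.S j = C from
        Function.update_self j C fun j => (⊤ : Submodule F (V.M j))]
      exact hC
    · rw [hWj j h,
        show W'.S j = ⊤ from
          Function.update_of_ne h C fun j => (⊤ : Submodule F (V.M j))]
      exact isCompl_bot_top
  have hW : ∀ j, W.S j = ⊤ := fun j => by
    have hb := Subrep.eq_bot_of_indec_of_isCompl hV W W' hcompl (i := i)
      (by rwa [hWi, Ne, Submodule.span_singleton_eq_bot]) j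
    have := (hcompl j).sup_eq_top
    rwa [hb, sup_bot_eq] at this
  refine ⟨?_, fun j hj y => ?_, fun a => LinearMap.ext fun y => ?_⟩
  · rw [← finrank_top F (V.M i), ← hW i, hWi, finrank_span_singleton hx]
  · have hy : y ∈ W.S j := hW j ▸ Submodule.mem_top
    rw [hWj j hj] at hy
    exact (Submodule.mem_bot F).1 hy
  · exact hspan a y (show y ∈ W.S (Q.s a) from hW _ ▸ Submodule.mem_top)

/-- The range of `sumIn` contains the image of every arrow entering `i`. -/
theorem castLE_map_mem_range_sumIn (V : QRep F Q) {i : Q.V} (a : Q.A) (h : Q.t a = i)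
    (y : V.M (Q.s a)) : V.castLE h (V.map a y) ∈ LinearMap.range (V.sumIn i) := by
  classical
  exact ⟨DirectSum.lof F {a : Q.A // Q.t a = i} (fun a => V.M (Q.s a.1)) ⟨a, h⟩ y,
    DirectSum.toModule_lof F (φ := fun b : {a : Q.A // Q.t a = i} =>
      (V.castLE b.2).toLinearMap ∘ₗ V.map b.1) ⟨a, h⟩ y⟩

end QRep

/-- Let `V` be an indecomposable representation of a quiver which is
not isomorphic to `L_i`. If `i` is a sink then `Σ_{t(a)=i} V(a)` is surjective; if `i`
is a source then `(V(a))_{s(a)=i}` is injective. -/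
theorem stmt8 (F : Type) [Field F] (Q : Quiv) (V : QRep F Q) (i : Q.V)
    (hInd : V.Indec) (hL : ¬ V.IsoToL i) :
    (Q.IsSink i → Function.Surjective (V.sumIn i)) ∧
    (Q.IsSource i → Function.Injective (V.prodOut i)) := by
  refine ⟨fun hi => ?_, fun hi => ?_⟩
  · by_contra hsurj
    obtain ⟨x, hx⟩ := not_forall.1 hsurj
    have hx0 : x ≠ 0 := fun e => hx ⟨0, by rw [map_zero, e]⟩
    have hdisj : Disjoint (LinearMap.range (V.sumIn i)) (F ∙ x) :=
      (Submodule.disjoint_span_singleton' hx0).2 hx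
    obtain ⟨C, hC, hcompl⟩ := hdisj.exists_isCompl
    exact hL (hInd.isoToL hx0 hcompl.symm (fun a h => absurd h (hi a))
      fun a h y => hC (V.castLE_map_mem_range_sumIn a h y))
  · refine (injective_iff_map_eq_zero _).2 fun x hx => ?_
    by_contra hx0
    obtain ⟨C, hC⟩ := exists_isCompl (F ∙ x)
    exact hL (hInd.isoToL hx0 hC (fun a h => congrFun hx ⟨a, h⟩)
      fun a h => absurd h (hi a))
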